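/- Let r, s > 0 and let X be exponentially distributed with rate parameter λ > 0, with density f(x) = λ e^{−λx} 1_{{x>0}}. Let (α_n)_{n≥1} be an asymptotically L^r(P)-optimal sequence of quantizers for X with card α_n = n, and set θ* = (s+1)/(r+1). Then the sequence (θ*·α_n)_{n≥1} satisfies the L^s empirical measure theorem: for all 0 ≤ a ≤ b, (1/n)·card(θ*·α_n ∩ [a,b]) → (1/C_{f,s}) ∫_a^b f(x)^{1/(1+s)} dx as n → ∞, where C_{f,s} = ∫_0^∞ f(x)^{1/(1+s)} dx = λ^{−s/(1+s)} (1+s). -/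

import Mathlib

open MeasureTheory ENNReal Filter Set Metric Topology
open scoped Classical

noncomputable section

/-- Distance from a point `x ∈ ℝ` to a finite codebook `α`. -/
def qdist1 (x : ℝ) (α : Finset ℝ) : ℝ := Metric.infDist x (α : Set ℝ)

/-- The `r`-th power `L^r` quantization error `∫ d(x,α)^r dP` of a codebook `α`. -/
def qerr1 (P : Measure ℝ) (r : ℝ) (α : Finset ℝ) : ℝ≥0∞ :=
  ∫⁻ x, ENNReal.ofReal (qdist1 x α) ^ r ∂P

/-- The optimal `n`-level `L^r` quantization error `e_{n,r}(P)`. -/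
def enr1 (P : Measure ℝ) (r : ℝ) (n : ℕ) : ℝ≥0∞ :=
  ⨅ (α : Finset ℝ) (_ : α.Nonempty) (_ : α.card ≤ n), qerr1 P r α ^ (1 / r)

/-- The constant `J_{r,1} = inf_{n ≥ 1} n^r e_{n,r}(U([0,1]))^r`. -/
def J1 (r : ℝ) : ℝ≥0∞ :=
  ⨅ (n : ℕ) (_ : 1 ≤ n), (n : ℝ≥0∞) ^ r * enr1 (volume.restrict (Icc (0 : ℝ) 1)) r n ^ r

/-- Zador's constant `Q_r(P)` on `ℝ` for `P = f·λ_1`. -/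
def Q1 (f : ℝ → ℝ) (r : ℝ) : ℝ≥0∞ :=
  J1 r * (∫⁻ x, ENNReal.ofReal (f x) ^ (1 / (1 + r))) ^ (1 + r : ℝ)

/-- The scaled codebook `θ·α = {θa : a ∈ α}`. -/
def scaleCB (θ : ℝ) (α : Finset ℝ) : Finset ℝ := α.image fun a => θ * a

/-- An `L^r(P)`-optimal sequence of `n`-quantizers on `ℝ`. -/
def OptimalSeq1 (P : Measure ℝ) (r : ℝ) (α : ℕ → Finset ℝ) : Prop :=
  ∀ n, 1 ≤ n → (α n).Nonempty ∧ (α n).card ≤ n ∧ qerr1 P r (α n) = enr1 P r n ^ r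

/-- An asymptotically `L^r(P)`-optimal sequence of quantizers on `ℝ`, `P = f·λ_1`. -/
def AsympOptimalSeq1 (P : Measure ℝ) (f : ℝ → ℝ) (r : ℝ) (α : ℕ → Finset ℝ) : Prop :=
  (∀ n, 1 ≤ n → (α n).Nonempty ∧ (α n).card ≤ n) ∧
  Tendsto (fun n : ℕ => (n : ℝ≥0∞) ^ r * qerr1 P r (α n)) atTop (𝓝 (Q1 f r))

/-- `L^s(P)`-rate-optimality of a sequence of codebooks on `ℝ`. -/
def RateOptimal1 (P : Measure ℝ) (s : ℝ) (β : ℕ → Finset ℝ) : Prop :=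
  limsup (fun n : ℕ => (n : ℝ≥0∞) ^ s * qerr1 P s (β n)) atTop < ⊤

/-- The density of the exponential distribution with rate `l`. -/
def expDensity (l x : ℝ) : ℝ := if 0 < x then l * Real.exp (-(l * x)) else 0


theorem lintegral_abs_sub_rpow {r : ℝ} (hr : 0 < r) (a : ℝ) {T : ℝ} (hT : 0 ≤ T) :
    ∫⁻ x in Icc (a - T) (a + T), ENNReal.ofReal (|x - a| ^ r) =
      ENNReal.ofReal (2 * (T ^ (r + 1) / (r + 1))) := by
  have hc : Continuous fun x : ℝ => |x| ^ r :=
    continuous_abs.rpow_const fun _ => Or.inr hr.le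
  have half : ∫ x in (0 : ℝ)..T, |x| ^ r = T ^ (r + 1) / (r + 1) := by
    rw [intervalIntegral.integral_congr (g := fun x : ℝ => x ^ r)]
    · rw [integral_rpow (Or.inl (by linarith)), Real.zero_rpow (by linarith), sub_zero]
    · intro x hx
      rw [uIcc_of_le hT] at hx
      simp only [abs_of_nonneg hx.1]
  have half' : ∫ x in (-T)..(0 : ℝ), |x| ^ r = T ^ (r + 1) / (r + 1) := by
    have := intervalIntegral.integral_comp_neg (a := 0) (b := T) fun x : ℝ => |x| ^ r
    simp only [abs_neg, neg_zero] at this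
    rw [← this, half]
  rw [← ofReal_integral_eq_lintegral_ofReal, integral_Icc_eq_integral_Ioc,
    ← intervalIntegral.integral_of_le (by linarith),
    intervalIntegral.integral_comp_sub_right (fun x : ℝ => |x| ^ r) a]
  · congr 1
    rw [show a - T - a = -T by ring, show a + T - a = T by ring,
      ← intervalIntegral.integral_add_adjacent_intervals (b := 0)
        (hc.intervalIntegrable _ _) (hc.intervalIntegrable _ _), half, half']
    ring
  · exact (hc.comp (continuous_sub_right a)).continuousOn.integrableOn_compact isCompact_Icc
  · exact Eventually.of_forall fun x => by positivity

theorem lintegral_bump_le {r : ℝ} (hr : 0 < r) (a : ℝ) {T : ℝ} (hT : 0 ≤ T) :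
    ∫⁻ x, ENNReal.ofReal (T ^ r - |x - a| ^ r) ≤
      ENNReal.ofReal (2 * (r / (r + 1)) * T ^ (r + 1)) := by
  have hsupp : ∫⁻ x, ENNReal.ofReal (T ^ r - |x - a| ^ r) =
      ∫⁻ x in Icc (a - T) (a + T), ENNReal.ofReal (T ^ r - |x - a| ^ r) := by
    symm
    apply setLIntegral_eq_of_support_subset
    intro x hx
    by_contra hx'
    apply hx
    apply ENNReal.ofReal_of_nonpos
    have : T ≤ |x - a| := by
      by_contra! h
      rw [abs_lt] at h
      exact hx' ⟨by linarith, by linarith⟩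
    have := Real.rpow_le_rpow hT this hr.le
    linarith
  have hm : Measurable fun x : ℝ => ENNReal.ofReal (|x - a| ^ r) := by fun_prop
  have hsum : (∫⁻ x in Icc (a - T) (a + T), ENNReal.ofReal (T ^ r - |x - a| ^ r)) +
      ∫⁻ x in Icc (a - T) (a + T), ENNReal.ofReal (|x - a| ^ r) =
        ENNReal.ofReal (2 * T ^ (r + 1)) := by
    rw [← lintegral_add_right _ hm, setLIntegral_congr_fun (g := fun _ => ENNReal.ofReal (T ^ r))
      measurableSet_Icc]
    · rw [setLIntegral_const, Real.volume_Icc, ← ENNReal.ofReal_mul (by positivity)]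
      congr 1
      rw [Real.rpow_add_one' hT (by linarith)]
      ring
    · intro x hx
      have h1 : |x - a| ≤ T := abs_le.2 ⟨by linarith [hx.1], by linarith [hx.2]⟩
      have h2 := Real.rpow_le_rpow (abs_nonneg _) h1 hr.le
      simp only
      rw [← ENNReal.ofReal_add (by linarith) (by positivity)]
      congr 1
      ring
  rw [lintegral_abs_sub_rpow hr a hT] at hsum
  have hsub := ENNReal.eq_sub_of_add_eq ENNReal.ofReal_ne_top hsum
  rw [hsupp, hsub,
    ← ENNReal.ofReal_sub _ (by positivity)]
  apply le_of_eq
  congr 1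
  field_simp
  ring

theorem J1_le {r : ℝ} (hr : 0 < r) :
    J1 r ≤ ENNReal.ofReal (2 * ((1 / 2 : ℝ) ^ (r + 1) / (r + 1))) := by
  refine (iInf₂_le 1 le_rfl).trans ?_
  have h1 : enr1 (volume.restrict (Icc (0 : ℝ) 1)) r 1 ≤
      qerr1 (volume.restrict (Icc (0 : ℝ) 1)) r {1 / 2} ^ (1 / r) :=
    (iInf_le _ _).trans ((iInf_le _ (by simp)).trans (iInf_le _ (by simp)))
  have h2 := ENNReal.rpow_le_rpow h1 hr.le
  rw [← ENNReal.rpow_mul, one_div_mul_cancel hr.ne', ENNReal.rpow_one] at h2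
  simp only [Nat.cast_one, ENNReal.one_rpow, one_mul]
  refine h2.trans (le_of_eq ?_)
  rw [← lintegral_abs_sub_rpow hr (1 / 2) (by norm_num : (0 : ℝ) ≤ 1 / 2)]
  unfold qerr1 qdist1
  norm_num
  refine lintegral_congr fun x => ?_
  rw [ENNReal.ofReal_rpow_of_nonneg dist_nonneg hr.le, Real.dist_eq]

theorem expDensity_nonneg {l : ℝ} (hl : 0 ≤ l) (x : ℝ) : 0 ≤ expDensity l x := by
  rw [expDensity]
  split_ifs <;> positivity

theorem expDensity_rpow {l : ℝ} (hl : 0 < l) (t : ℝ) {x : ℝ} (hx : 0 < x) :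
    expDensity l x ^ (1 / (1 + t)) =
      l ^ (1 / (1 + t)) * Real.exp (-(l / (1 + t)) * x) := by
  rw [expDensity, if_pos hx, Real.mul_rpow hl.le (Real.exp_pos _).le, ← Real.exp_mul]
  congr 2
  ring

theorem integral_expDensity_rpow {l t : ℝ} (hl : 0 < l) (ht : 0 < t) :
    ∫ x in Ioi (0 : ℝ), expDensity l x ^ (1 / (1 + t)) =
      l ^ (1 / (1 + t)) * (1 / (l / (1 + t))) := by
  have hν : 0 < l / (1 + t) := by positivity
  rw [setIntegral_congr_fun measurableSet_Ioi fun x hx => expDensity_rpow hl t hx,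
    integral_const_mul, integral_exp_mul_Ioi (by linarith)]
  simp [neg_div_neg_eq]

theorem lintegral_expDensity_rpow {l t : ℝ} (hl : 0 < l) (ht : 0 < t) :
    ∫⁻ x, ENNReal.ofReal (expDensity l x) ^ (1 / (1 + t)) =
      ENNReal.ofReal (l ^ (1 / (1 + t)) * (1 / (l / (1 + t)))) := by
  have hν : 0 < l / (1 + t) := by positivity
  rw [← integral_expDensity_rpow hl ht, ofReal_integral_eq_lintegral_ofReal]
  · rw [← setLIntegral_eq_of_support_subset (s := Ioi 0)]
    · refine setLIntegral_congr_fun measurableSet_Ioi fun x hx => ?_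
      rw [ENNReal.ofReal_rpow_of_nonneg (expDensity_nonneg hl.le x) (by positivity)]
    · intro x hx
      by_contra h
      apply hx
      have h0 : expDensity l x = 0 := if_neg h
      have h1 : 0 < 1 / (1 + t) := by positivity
      simp only [h0, ENNReal.ofReal_zero, ENNReal.zero_rpow_of_pos h1]
  · refine IntegrableOn.congr_fun ?_ (fun x hx => (expDensity_rpow hl t hx).symm)
      measurableSet_Ioi
    exact (integrableOn_exp_mul_Ioi (by linarith) 0).const_mul _
  · filter_upwards [ae_restrict_mem measurableSet_Ioi] with x hx
    rw [expDensity_rpow hl t hx]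
    positivity

theorem setIntegral_Icc_expDensity_rpow {l t a b : ℝ} (hl : 0 < l) (ht : 0 < t)
    (ha : 0 ≤ a) (hab : a ≤ b) :
    ∫ x in Icc a b, expDensity l x ^ (1 / (1 + t)) =
      l ^ (1 / (1 + t)) * (1 / (l / (1 + t))) *
        (Real.exp (-(l / (1 + t)) * a) - Real.exp (-(l / (1 + t)) * b)) := by
  have hν : 0 < l / (1 + t) := by positivity
  rw [integral_Icc_eq_integral_Ioc,
    setIntegral_congr_fun measurableSet_Ioc
      fun x hx => expDensity_rpow hl t (ha.trans_lt hx.1),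
    integral_const_mul, ← intervalIntegral.integral_of_le hab,
    intervalIntegral.integral_comp_mul_left (fun x => Real.exp x) (neg_ne_zero.2 hν.ne'),
    integral_exp]
  simp only [smul_eq_mul, inv_neg]
  field_simp
  ring

theorem Q1_expDensity_le {l r : ℝ} (hl : 0 < l) (hr : 0 < r) :
    Q1 (expDensity l) r ≤
      ENNReal.ofReal (2 * (l / (2 * (l / (1 + r))) ^ (r + 1)) * (1 - r / (r + 1))) := by
  have hν : 0 < l / (1 + r) := by positivity
  rw [Q1, lintegral_expDensity_rpow hl hr]
  refine (mul_le_mul_left (J1_le hr) _).trans (le_of_eq ?_)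
  rw [ENNReal.ofReal_rpow_of_nonneg (by positivity) (by positivity),
    ← ENNReal.ofReal_mul (by positivity)]
  congr 1
  rw [Real.mul_rpow (by positivity) (by positivity), ← Real.rpow_mul hl.le,
    one_div_mul_cancel (by positivity), Real.rpow_one, add_comm 1 r,
    Real.mul_rpow (x := 2) (by positivity) (by positivity),
    Real.div_rpow (x := 1) (by positivity) (by positivity),
    Real.div_rpow (x := 1) (by positivity) (by positivity)]
  simp only [Real.one_rpow]
  field_simp
  ring

theorem measurable_expDensity (l : ℝ) : Measurable (expDensity l) :=
  Measurable.ite measurableSet_Ioi (by fun_prop) measurable_const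

theorem qerr1_withDensity {f : ℝ → ℝ} (hf : Measurable f) (r : ℝ) (α : Finset ℝ) :
    qerr1 (volume.withDensity fun x => ENNReal.ofReal (f x)) r α =
      ∫⁻ x, ENNReal.ofReal (f x) * ENNReal.ofReal (qdist1 x α) ^ r := by
  have hd : Measurable fun x => ENNReal.ofReal (qdist1 x α) ^ r :=
    ((Metric.continuous_infDist_pt (α : Set ℝ)).measurable.ennreal_ofReal).pow_const r
  rw [qerr1, lintegral_withDensity_eq_lintegral_mul _ hf.ennreal_ofReal hd]
  rfl

theorem ofReal_rpow_le_qdist1_add_sum {r : ℝ} (hr : 0 ≤ r) {α : Finset ℝ} (hα : α.Nonempty)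
    (T x : ℝ) :
    ENNReal.ofReal (T ^ r) ≤ ENNReal.ofReal (qdist1 x α) ^ r +
      ∑ a ∈ α, ENNReal.ofReal (T ^ r - |x - a| ^ r) := by
  obtain ⟨a, ha, hxa⟩ := α.finite_toSet.isCompact.exists_infDist_eq_dist hα x
  have h : ENNReal.ofReal (T ^ r) ≤ ENNReal.ofReal (|x - a| ^ r) +
      ENNReal.ofReal (T ^ r - |x - a| ^ r) := by
    refine le_trans (le_of_eq ?_) ENNReal.ofReal_add_le
    congr 1
    ring
  rw [qdist1, hxa, Real.dist_eq, ENNReal.ofReal_rpow_of_nonneg (abs_nonneg _) hr]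
  refine h.trans (add_le_add le_rfl ?_)
  exact Finset.single_le_sum (f := fun a => ENNReal.ofReal (T ^ r - |x - a| ^ r))
    (fun _ _ => zero_le) ha

theorem bump_le_bump {r l c δ κ T a x : ℝ} (hr : 0 < r) (hl : 0 < l) (hT : 0 ≤ T)
    (hx : 0 < x) (hTδ : T ≤ δ)
    (hc : |x - a| ≤ δ → expDensity l x * T ^ (r + 1) ≤ c)
    (hκ : κ = c * Real.exp (2 * l * δ) / (l * Real.exp (-(l * (a - δ))))) :
    ENNReal.ofReal (expDensity l x) * ENNReal.ofReal (T ^ r - |x - a| ^ r) ≤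
      ENNReal.ofReal (l * Real.exp (-(l * (a - δ)))) *
        ENNReal.ofReal ((κ ^ (1 / (r + 1))) ^ r - |x - a| ^ r) := by
  rcases le_or_gt T |x - a| with h | h
  · have := Real.rpow_le_rpow hT h hr.le
    rw [ENNReal.ofReal_of_nonpos (p := T ^ r - |x - a| ^ r) (by linarith), mul_zero]
    exact zero_le
  have hxa : |x - a| ≤ δ := h.le.trans hTδ
  have hxa' := abs_le.1 hxa
  specialize hc hxa
  have hf : expDensity l x = l * Real.exp (-(l * x)) := if_pos hx
  have hle : expDensity l x ≤ l * Real.exp (-(l * (a - δ))) := by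
    rw [hf]
    gcongr
    linarith
  have hge : l * Real.exp (-(l * (a - δ))) ≤ expDensity l x * Real.exp (2 * l * δ) := by
    rw [hf, mul_assoc, ← Real.exp_add]
    gcongr
    nlinarith
  have hTκ : T ≤ κ ^ (1 / (r + 1)) := by
    have hpow : T ^ (r + 1) ≤ κ := by
      rw [hκ, le_div_iff₀ (by positivity)]
      calc T ^ (r + 1) * (l * Real.exp (-(l * (a - δ))))
          ≤ T ^ (r + 1) * (expDensity l x * Real.exp (2 * l * δ)) := by gcongr
        _ = expDensity l x * T ^ (r + 1) * Real.exp (2 * l * δ) := by ring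
        _ ≤ _ := by gcongr
    calc T = (T ^ (r + 1)) ^ (1 / (r + 1)) := by
          rw [← Real.rpow_mul hT, mul_one_div_cancel (by linarith), Real.rpow_one]
      _ ≤ _ := Real.rpow_le_rpow (by positivity) hpow (by positivity)
  gcongr

theorem lintegral_bump_expDensity_le {r l c δ a : ℝ} (hr : 0 < r) (hl : 0 < l) (hc : 0 ≤ c)
    {s : Set ℝ} (hs : MeasurableSet s) {T : ℝ → ℝ} (hT : ∀ x ∈ s, 0 ≤ T x)
    (hs0 : ∀ x ∈ s, 0 < x) (hTδ : ∀ x ∈ s, T x ≤ δ)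
    (hTc : ∀ x ∈ s, |x - a| ≤ δ → expDensity l x * T x ^ (r + 1) ≤ c) :
    ∫⁻ x in s, ENNReal.ofReal (expDensity l x) * ENNReal.ofReal (T x ^ r - |x - a| ^ r) ≤
      ENNReal.ofReal (2 * (r / (r + 1)) * (c * Real.exp (2 * l * δ))) := by
  obtain ⟨κ, hκ⟩ : ∃ κ, κ = c * Real.exp (2 * l * δ) / (l * Real.exp (-(l * (a - δ)))) :=
    ⟨_, rfl⟩
  have hκ0 : 0 ≤ κ := hκ ▸ by positivity
  have hF : 0 < l * Real.exp (-(l * (a - δ))) := by positivity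
  calc _ ≤ ∫⁻ x in s, ENNReal.ofReal (l * Real.exp (-(l * (a - δ)))) *
        ENNReal.ofReal ((κ ^ (1 / (r + 1))) ^ r - |x - a| ^ r) :=
        setLIntegral_mono' hs fun x hx =>
          bump_le_bump hr hl (hT x hx) (hs0 x hx) (hTδ x hx) (hTc x hx) hκ
    _ ≤ ∫⁻ x, ENNReal.ofReal (l * Real.exp (-(l * (a - δ)))) *
        ENNReal.ofReal ((κ ^ (1 / (r + 1))) ^ r - |x - a| ^ r) := setLIntegral_le_lintegral _ _
    _ = ENNReal.ofReal (l * Real.exp (-(l * (a - δ)))) *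
        ∫⁻ x, ENNReal.ofReal ((κ ^ (1 / (r + 1))) ^ r - |x - a| ^ r) :=
        lintegral_const_mul' _ _ ENNReal.ofReal_ne_top
    _ ≤ ENNReal.ofReal (l * Real.exp (-(l * (a - δ)))) *
        ENNReal.ofReal (2 * (r / (r + 1)) * (κ ^ (1 / (r + 1))) ^ (r + 1)) := by
        gcongr
        exact lintegral_bump_le hr a (by positivity)
    _ = _ := by
        rw [← ENNReal.ofReal_mul hF.le, ← Real.rpow_mul hκ0, one_div_mul_cancel (by linarith),
          Real.rpow_one, hκ]
        congr 1
        field_simp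

theorem setLIntegral_le_qerr1_add_sum {r l δ : ℝ} (hr : 0 < r) (hl : 0 < l)
    {s : Set ℝ} (hs : MeasurableSet s) {T : ℝ → ℝ} (hTm : Measurable T)
    (hT : ∀ x ∈ s, 0 ≤ T x)
    (hs0 : ∀ x ∈ s, 0 < x) (hTδ : ∀ x ∈ s, T x ≤ δ) {α : Finset ℝ} (hα : α.Nonempty)
    {k : ℝ → ℝ} (hk : ∀ a, 0 ≤ k a)
    (hTk : ∀ a, ∀ x ∈ s, |x - a| ≤ δ → expDensity l x * T x ^ (r + 1) ≤ k a) :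
    ∫⁻ x in s, ENNReal.ofReal (expDensity l x * T x ^ r) ≤
      qerr1 (volume.withDensity fun x => ENNReal.ofReal (expDensity l x)) r α +
        ENNReal.ofReal (2 * (r / (r + 1)) * Real.exp (2 * l * δ) * ∑ a ∈ α, k a) := by
  have hfm := measurable_expDensity l
  have hbm : ∀ a ∈ α, Measurable fun x =>
      ENNReal.ofReal (expDensity l x) * ENNReal.ofReal (T x ^ r - |x - a| ^ r) := by
    intro a _
    fun_prop
  calc ∫⁻ x in s, ENNReal.ofReal (expDensity l x * T x ^ r)
      ≤ ∫⁻ x in s, (ENNReal.ofReal (expDensity l x) * ENNReal.ofReal (qdist1 x α) ^ r +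
        ∑ a ∈ α, ENNReal.ofReal (expDensity l x) * ENNReal.ofReal (T x ^ r - |x - a| ^ r)) := by
        refine lintegral_mono fun x => ?_
        rw [ENNReal.ofReal_mul (expDensity_nonneg hl.le x), ← Finset.mul_sum, ← mul_add]
        gcongr
        exact ofReal_rpow_le_qdist1_add_sum hr.le hα _ _
    _ = (∫⁻ x in s, ENNReal.ofReal (expDensity l x) * ENNReal.ofReal (qdist1 x α) ^ r) +
        ∑ a ∈ α, ∫⁻ x in s,
          ENNReal.ofReal (expDensity l x) * ENNReal.ofReal (T x ^ r - |x - a| ^ r) := by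
        rw [lintegral_add_right _ (Finset.measurable_sum _ hbm), lintegral_finsetSum _ hbm]
    _ ≤ _ := by
        rw [qerr1_withDensity hfm, Finset.mul_sum,
          ENNReal.ofReal_sum_of_nonneg fun a _ => mul_nonneg (by positivity) (hk a)]
        refine add_le_add (setLIntegral_le_lintegral _ _) (Finset.sum_le_sum fun a _ => ?_)
        refine (lintegral_bump_expDensity_le hr hl (hk a) hs hT hs0 hTδ (hTk a)).trans
          (le_of_eq ?_)
        congr 1
        ring

/-- Dual lower bound for the quantization error of an exponential distribution: `w` perturbs the
optimal point density and `k` dominates `w` on `δ`-neighbourhoods. -/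
theorem ofReal_mul_setLIntegral_le {r l m δ M : ℝ} (hr : 0 < r) (hm : 0 < m)
    (hl : l = (r + 1) * m) {w k : ℝ → ℝ} (hwm : Measurable w) (hw0 : ∀ x, 0 ≤ w x)
    (hw2 : ∀ x, w x ≤ 2) (hδ : 0 ≤ δ) (hwk : ∀ a x, |x - a| ≤ δ → w x ≤ k a)
    {α : Finset ℝ} (hα : α.Nonempty) {n : ℕ} (hn : 1 ≤ n)
    (hnδ : Real.exp (m * M) / m / n ≤ δ) :
    ENNReal.ofReal (2 * (l / (2 * m) ^ (r + 1))) *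
        ∫⁻ x in Ioc 0 M, ENNReal.ofReal (w x ^ (r / (r + 1)) * (m * Real.exp (-m * x))) ≤
      (n : ℝ≥0∞) ^ r *
          qerr1 (volume.withDensity fun x => ENNReal.ofReal (expDensity l x)) r α +
        ENNReal.ofReal (2 * (l / (2 * m) ^ (r + 1)) *
          (r / (r + 1) * Real.exp (2 * l * δ) * ((∑ a ∈ α, k a) / n))) := by
  have hl0 : 0 < l := by rw [hl]; positivity
  have hr1 : 0 < r + 1 := by linarith
  have hn0 : (0 : ℝ) < n := by exact_mod_cast hn
  have hk0 : ∀ a, 0 ≤ k a := fun a => (hw0 a).trans (hwk a a (by simpa using hδ))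
  set T : ℝ → ℝ := fun x => w x ^ (1 / (r + 1)) * (Real.exp (m * x) / (2 * m * n)) with hTdef
  have hT0 : ∀ x, 0 ≤ T x := fun x => by have := hw0 x; positivity
  have hwpow : ∀ x, w x ^ (1 / (r + 1)) ≤ 2 := fun x => by
    calc w x ^ (1 / (r + 1)) ≤ (2 : ℝ) ^ (1 / (r + 1)) :=
          Real.rpow_le_rpow (hw0 x) (hw2 x) (by positivity)
      _ ≤ (2 : ℝ) ^ (1 : ℝ) := Real.rpow_le_rpow_of_exponent_le (by norm_num)
          ((div_le_one hr1).2 (by linarith))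
      _ = 2 := Real.rpow_one _
  have hTδ : ∀ x ∈ Ioc 0 M, T x ≤ δ := fun x hx => by
    refine le_trans ?_ hnδ
    calc T x ≤ 2 * (Real.exp (m * M) / (2 * m * n)) := by
          have := hwpow x
          have := hx.2
          simp only [hTdef]
          gcongr
      _ = _ := by field_simp
  have hfT : ∀ x ∈ Ioc 0 M, expDensity l x * T x ^ (r + 1) =
      w x * (l / (2 * m) ^ (r + 1)) / (n : ℝ) ^ (r + 1) := fun x hx => by
    have hf : expDensity l x = l * Real.exp (-(l * x)) := if_pos hx.1
    have he : Real.exp (m * x) ^ (r + 1) = Real.exp (l * x) := by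
      rw [← Real.exp_mul, hl]
      ring_nf
    simp only [hTdef]
    rw [Real.mul_rpow (Real.rpow_nonneg (hw0 x) _) (by positivity), ← Real.rpow_mul (hw0 x),
      one_div_mul_cancel hr1.ne', Real.rpow_one, Real.div_rpow (by positivity) (by positivity),
      Real.mul_rpow (by positivity) hn0.le, he, hf, Real.exp_neg]
    field_simp
  have hfTr : ∀ x ∈ Ioc 0 M, expDensity l x * T x ^ r =
      ((n : ℝ) ^ r)⁻¹ * (2 * (l / (2 * m) ^ (r + 1))) *
        (w x ^ (r / (r + 1)) * (m * Real.exp (-m * x))) := fun x hx => by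
    have hf : expDensity l x = l * Real.exp (-(l * x)) := if_pos hx.1
    have he : Real.exp (-(l * x)) = Real.exp (-m * x) / Real.exp (m * x) ^ r := by
      rw [← Real.exp_mul, ← Real.exp_sub, hl]
      ring_nf
    simp only [hTdef]
    rw [Real.mul_rpow (Real.rpow_nonneg (hw0 x) _) (by positivity), ← Real.rpow_mul (hw0 x),
      one_div_mul_eq_div, Real.div_rpow (by positivity) (by positivity),
      Real.mul_rpow (by positivity) hn0.le, hf, he,
      Real.rpow_add_one (by positivity : 2 * m ≠ 0)]
    field_simp
  have key := setLIntegral_le_qerr1_add_sum hr hl0 measurableSet_Ioc (T := T) (by fun_prop)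
    (fun x _ => hT0 x) (fun x (hx : x ∈ Ioc 0 M) => hx.1) hTδ hα
    (k := fun a => k a * (l / (2 * m) ^ (r + 1)) / (n : ℝ) ^ (r + 1))
    (fun a => by have := hk0 a; positivity)
    (fun a x hx hxa => by
      rw [hfT x hx]
      have := hwk a x hxa
      gcongr)
  have hnr : (n : ℝ≥0∞) ^ r = ENNReal.ofReal ((n : ℝ) ^ r) := by
    rw [← ENNReal.ofReal_rpow_of_pos hn0, ENNReal.ofReal_natCast]
  calc _ = (n : ℝ≥0∞) ^ r * ∫⁻ x in Ioc 0 M, ENNReal.ofReal (expDensity l x * T x ^ r) := by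
        rw [hnr, ← lintegral_const_mul' _ _ ENNReal.ofReal_ne_top,
          ← lintegral_const_mul' _ _ ENNReal.ofReal_ne_top]
        refine setLIntegral_congr_fun measurableSet_Ioc fun x hx => ?_
        rw [hfTr x hx, ← ENNReal.ofReal_mul (by positivity), ← ENNReal.ofReal_mul (by positivity)]
        congr 1
        field_simp
    _ ≤ _ := mul_le_mul_right key _
    _ = _ := by
        rw [mul_add]
        congr 1
        rw [hnr, ← ENNReal.ofReal_mul (by positivity), ← Finset.sum_div, ← Finset.sum_mul,
          Real.rpow_add_one hn0.ne']
        congr 1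
        field_simp

theorem setIntegral_Ioc_exp_neg {m u v : ℝ} (hm : 0 < m) (huv : u ≤ v) :
    ∫ x in Ioc u v, m * Real.exp (-m * x) = Real.exp (-m * u) - Real.exp (-m * v) := by
  rw [integral_const_mul, ← intervalIntegral.integral_of_le huv,
    intervalIntegral.integral_comp_mul_left (fun x => Real.exp x) (neg_ne_zero.2 hm.ne'),
    integral_exp]
  simp only [smul_eq_mul, inv_neg]
  field_simp
  ring

theorem setIntegral_indicator_Icc_le {m M e δ : ℝ} (hm : 0 ≤ m) (hδ : 0 ≤ δ) :
    ∫ x in Ioc 0 M, (Icc (e - δ) (e + δ)).indicator (fun _ => m) x ≤ 2 * δ * m := by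
  rw [setIntegral_indicator measurableSet_Icc, setIntegral_const, smul_eq_mul]
  gcongr
  calc volume.real (Ioc 0 M ∩ Icc (e - δ) (e + δ)) ≤ volume.real (Icc (e - δ) (e + δ)) :=
        measureReal_mono inter_subset_right (by simp)
    _ = 2 * δ := by
        rw [Real.volume_real_Icc_of_le (by linarith)]
        ring

theorem ofReal_le_setLIntegral_weight {m M c d δ ε ρ : ℝ} (hm : 0 < m) (hc : 0 ≤ c)
    (hcd : c ≤ d) (hdM : d ≤ M) (hδ : 0 ≤ δ) (hε : |ε| < 1) (hρ0 : 0 ≤ ρ) (hρ1 : ρ ≤ 1)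
    {A : Set ℝ} (hA : MeasurableSet A)
    (hAS : ∀ x, x ∉ Icc (c - δ) (c + δ) → x ∉ Icc (d - δ) (d + δ) → (x ∈ A ↔ x ∈ Ioc c d)) :
    ENNReal.ofReal (1 - Real.exp (-m * M) +
        ((1 + ε) ^ ρ - 1) * (Real.exp (-m * c) - Real.exp (-m * d)) - 4 * δ * m) ≤
      ∫⁻ x in Ioc 0 M, ENNReal.ofReal
        ((1 + ε * A.indicator 1 x) ^ ρ * (m * Real.exp (-m * x))) := by
  have hε' := abs_lt.1 hε
  set γ := (1 + ε) ^ ρ - 1 with hγ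
  have hγ1 : |γ| ≤ 1 := by
    have h0 : 0 ≤ (1 + ε) ^ ρ := Real.rpow_nonneg (by linarith) _
    have h2 : (1 + ε) ^ ρ ≤ 2 := by
      calc (1 + ε) ^ ρ ≤ (2 : ℝ) ^ ρ := Real.rpow_le_rpow (by linarith) (by linarith) hρ0
        _ ≤ (2 : ℝ) ^ (1 : ℝ) := Real.rpow_le_rpow_of_exponent_le (by norm_num) hρ1
        _ = 2 := Real.rpow_one _
    rw [abs_le]
    constructor <;> linarith
  have hγ2 := abs_le.1 hγ1
  have hw : ∀ x, (1 + ε * A.indicator 1 x) ^ ρ = 1 + γ * A.indicator 1 x := fun x => by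
    by_cases hx : x ∈ A <;> simp [hx, hγ]
  have hw0 : ∀ x, 0 ≤ 1 + γ * A.indicator 1 x := fun x => by
    by_cases hx : x ∈ A <;> simp [hx]; linarith
  simp only [hw]
  have hexp : Continuous fun x => m * Real.exp (-m * x) := by fun_prop
  have hfi : ∀ s : Set ℝ, MeasurableSet s → IntegrableOn
      (s.indicator fun x => m * Real.exp (-m * x)) (Ioc 0 M) := fun s hs =>
    Integrable.indicator ((hexp.continuousOn.integrableOn_compact isCompact_Icc).mono_set
      Ioc_subset_Icc_self) hs
  have hfi0 : IntegrableOn (fun x => m * Real.exp (-m * x)) (Ioc 0 M) :=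
    (hexp.continuousOn.integrableOn_compact isCompact_Icc).mono_set Ioc_subset_Icc_self
  have hfic : ∀ e, IntegrableOn ((Icc (e - δ) (e + δ)).indicator fun _ => m) (Ioc 0 M) :=
    fun e => Integrable.indicator (integrable_const _) measurableSet_Icc
  have hrw : ∀ (s : Set ℝ) (x : ℝ), (1 + γ * s.indicator 1 x) * (m * Real.exp (-m * x)) =
      m * Real.exp (-m * x) + γ * s.indicator (fun x => m * Real.exp (-m * x)) x := by
    intro s x
    by_cases hx : x ∈ s <;> simp [hx]
    ring
  rw [← ofReal_integral_eq_lintegral_ofReal]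
  rotate_left
  · simp only [hrw]
    exact hfi0.add ((hfi A hA).const_mul _)
  · exact Eventually.of_forall fun x => mul_nonneg (hw0 x) (by positivity)
  apply ENNReal.ofReal_le_ofReal
  have hlow : ∫ x in Ioc 0 M, (m * Real.exp (-m * x) +
      γ * (Ioc c d).indicator (fun x => m * Real.exp (-m * x)) x -
      ((Icc (c - δ) (c + δ)).indicator (fun _ => m) x +
        (Icc (d - δ) (d + δ)).indicator (fun _ => m) x)) ≤
      ∫ x in Ioc 0 M, (1 + γ * A.indicator 1 x) * (m * Real.exp (-m * x)) := by
    refine setIntegral_mono_on ((hfi0.add ((hfi _ measurableSet_Ioc).const_mul _)).sub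
      ((hfic c).add (hfic d))) ?_ measurableSet_Ioc fun x hx => ?_
    · simp only [hrw]
      exact hfi0.add ((hfi A hA).const_mul _)
    · have he : Real.exp (-m * x) ≤ 1 := Real.exp_le_one_iff.2 (by nlinarith [hx.1])
      have he0 := Real.exp_pos (-m * x)
      rw [hrw]
      by_cases h1 : x ∈ Icc (c - δ) (c + δ) ∨ x ∈ Icc (d - δ) (d + δ)
      · have hE : m ≤ (Icc (c - δ) (c + δ)).indicator (fun _ => m) x +
            (Icc (d - δ) (d + δ)).indicator (fun _ => m) x := by
          rcases h1 with h | h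
          · rw [indicator_of_mem h]
            exact le_add_of_nonneg_right (indicator_nonneg (fun _ _ => hm.le) _)
          · rw [indicator_of_mem h]
            exact le_add_of_nonneg_left (indicator_nonneg (fun _ _ => hm.le) _)
        have hme : m * Real.exp (-m * x) ≤ m := by nlinarith
        have hme0 : 0 ≤ m * Real.exp (-m * x) := by positivity
        by_cases h2 : x ∈ A <;> by_cases h3 : x ∈ Ioc c d <;>
          simp only [indicator_of_mem, indicator_of_notMem, h2, h3, not_false_eq_true] <;>
          nlinarith
      · push Not at h1
        have := hAS x h1.1 h1.2
        rw [indicator_of_notMem h1.1, indicator_of_notMem h1.2]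
        by_cases h2 : x ∈ A
        · simp [h2, this.1 h2]
        · rw [indicator_of_notMem h2, indicator_of_notMem (mt this.2 h2)]
          simp
  refine le_trans ?_ hlow
  have hfiS := (hfi _ (measurableSet_Ioc (a := c) (b := d))).const_mul γ
  have hsub := integral_sub (hfi0.add hfiS) ((hfic c).add (hfic d))
  simp only [Pi.add_apply] at hsub
  rw [hsub, integral_add hfi0 hfiS, integral_add (hfic c) (hfic d), integral_const_mul γ,
    setIntegral_indicator measurableSet_Ioc,
    inter_eq_self_of_subset_right (Ioc_subset_Ioc hc hdM),
    setIntegral_Ioc_exp_neg hm hcd, setIntegral_Ioc_exp_neg hm (hc.trans (hcd.trans hdM))]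
  have h1 := setIntegral_indicator_Icc_le (M := M) (e := c) hm.le hδ
  have h2 := setIntegral_indicator_Icc_le (M := M) (e := d) hm.le hδ
  rw [mul_zero, Real.exp_zero]
  linarith

theorem exists_enlargement {c d δ ε : ℝ} (hδ : 0 ≤ δ) :
    ∃ A : Set ℝ, MeasurableSet A ∧
      (∀ x, x ∉ Icc (c - δ) (c + δ) → x ∉ Icc (d - δ) (d + δ) → (x ∈ A ↔ x ∈ Ioc c d)) ∧
      ∀ a x, |x - a| ≤ δ →
        1 + ε * A.indicator (1 : ℝ → ℝ) x ≤ 1 + ε * (Icc c d).indicator (1 : ℝ → ℝ) a := by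
  rcases le_or_gt 0 ε with hε | hε
  · refine ⟨Icc (c + δ) (d - δ), measurableSet_Icc, fun x h1 h2 => ?_, fun a x hxa => ?_⟩
    · simp only [mem_Icc, mem_Ioc, not_and_or, not_le] at *
      constructor
      · rintro ⟨h3, h4⟩
        grind
      · rintro ⟨h3, h4⟩
        grind
    · have hxa := abs_le.1 hxa
      gcongr
      by_cases hx : x ∈ Icc (c + δ) (d - δ)
      · have ha : a ∈ Icc c d := ⟨by linarith [hx.1], by linarith [hx.2]⟩
        simp [hx, ha]
      · rw [indicator_of_notMem hx]
        exact indicator_nonneg (fun _ _ => zero_le_one) _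
  · refine ⟨Icc (c - δ) (d + δ), measurableSet_Icc, fun x h1 h2 => ?_, fun a x hxa => ?_⟩
    · simp only [mem_Icc, mem_Ioc, not_and_or, not_le] at *
      constructor
      · rintro ⟨h3, h4⟩
        grind
      · rintro ⟨h3, h4⟩
        grind
    · have hxa := abs_le.1 hxa
      have : (Icc c d).indicator (1 : ℝ → ℝ) a ≤
          (Icc (c - δ) (d + δ)).indicator (1 : ℝ → ℝ) x := by
        by_cases ha : a ∈ Icc c d
        · have hx : x ∈ Icc (c - δ) (d + δ) := ⟨by linarith [ha.1], by linarith [ha.2]⟩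
          simp [hx, ha]
        · rw [indicator_of_notMem ha]
          exact indicator_nonneg (fun _ _ => zero_le_one) _
      nlinarith

theorem sum_one_add_mul_indicator_div {α : Finset ℝ} {n : ℕ} (hn : 1 ≤ n) (hα : α.card = n)
    (ε : ℝ) (S : Set ℝ) :
    (∑ a ∈ α, (1 + ε * S.indicator (1 : ℝ → ℝ) a)) / n =
      1 + ε * (((α : Set ℝ) ∩ S).ncard / n) := by
  have hn0 : (n : ℝ) ≠ 0 := by positivity
  have hcard : ∑ a ∈ α, S.indicator (1 : ℝ → ℝ) a = ((α : Set ℝ) ∩ S).ncard := by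
    have : (α : Set ℝ) ∩ S = (α.filter (· ∈ S) : Finset ℝ) := by
      ext x
      simp
    rw [this, Set.ncard_coe_finset, Finset.card_filter]
    simp [Set.indicator_apply]
  rw [Finset.sum_add_distrib, ← Finset.mul_sum, hcard, Finset.sum_const, hα]
  simp only [nsmul_eq_mul, mul_one]
  field_simp

theorem empirical_inequality_of_tendsto {r l m c d q ε : ℝ} (hr : 0 < r) (hm : 0 < m)
    (hl : l = (r + 1) * m) (hc : 0 ≤ c) (hcd : c ≤ d) (hε : |ε| < 1)
    {α : ℕ → Finset ℝ} (hcard : ∀ n, 1 ≤ n → (α n).card = n)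
    {U : Filter ℕ} [U.NeBot] (hU : U ≤ atTop)
    (hα : Tendsto (fun n : ℕ => (n : ℝ≥0∞) ^ r *
      qerr1 (volume.withDensity fun x => ENNReal.ofReal (expDensity l x)) r (α n)) U
        (𝓝 (Q1 (expDensity l) r)))
    (hq : Tendsto (fun n : ℕ => (((α n : Set ℝ) ∩ Icc c d).ncard : ℝ) / n) U (𝓝 q))
    (hq0 : 0 ≤ q) (hq1 : q ≤ 1) :
    ((1 + ε) ^ (r / (r + 1)) - 1) * (Real.exp (-m * c) - Real.exp (-m * d)) ≤
      r / (r + 1) * (ε * q) := by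
  have hl0 : 0 < l := by rw [hl]; positivity
  have hε' := abs_lt.1 hε
  have hr1 : 0 < r + 1 := by linarith
  have hρ1 : r / (r + 1) ≤ 1 := (div_le_one hr1).2 (by linarith)
  have hlm : l / (1 + r) = m := by
    rw [hl]
    field_simp
    ring
  have hK : 0 < 2 * (l / (2 * m) ^ (r + 1)) := by positivity
  have hqε : 0 ≤ 1 + ε * q := by nlinarith
  have hQ := Q1_expDensity_le hl0 hr
  rw [hlm] at hQ
  set p := Real.exp (-m * c) - Real.exp (-m * d)
  set γ := (1 + ε) ^ (r / (r + 1)) - 1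
  have hbound : ∀ δ > 0, ∀ M ≥ d, 1 - Real.exp (-m * M) + γ * p - 4 * δ * m ≤
      (1 - r / (r + 1)) + r / (r + 1) * Real.exp (2 * l * δ) * (1 + ε * q) := by
    intro δ hδ M hM
    obtain ⟨A, hA, hAS, hwk⟩ := exists_enlargement (c := c) (d := d) (ε := ε) hδ.le
    have hlow := ofReal_le_setLIntegral_weight (ρ := r / (r + 1)) hm hc hcd hM hδ.le hε
      (by positivity) hρ1 hA hAS
    have hev : ∀ᶠ n : ℕ in U, ENNReal.ofReal (2 * (l / (2 * m) ^ (r + 1))) *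
        ENNReal.ofReal (1 - Real.exp (-m * M) + γ * p - 4 * δ * m) ≤
        (n : ℝ≥0∞) ^ r *
          qerr1 (volume.withDensity fun x => ENNReal.ofReal (expDensity l x)) r (α n) +
        ENNReal.ofReal (2 * (l / (2 * m) ^ (r + 1)) *
          (r / (r + 1) * Real.exp (2 * l * δ) *
            (1 + ε * ((((α n : Set ℝ) ∩ Icc c d).ncard : ℝ) / n)))) := by
      have hsmall : ∀ᶠ n : ℕ in atTop, Real.exp (m * M) / m / n ≤ δ :=
        (tendsto_const_div_atTop_nhds_zero_nat (Real.exp (m * M) / m)).eventually_le_const hδ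
      filter_upwards [hU hsmall, hU (eventually_ge_atTop 1)] with n hn hn1
      rw [← sum_one_add_mul_indicator_div hn1 (hcard n hn1)]
      refine (mul_le_mul_right hlow _).trans
        (ofReal_mul_setLIntegral_le hr hm hl ?_ ?_ ?_ hδ.le hwk ?_ hn1 hn)
      · exact ((measurable_one.indicator hA).const_mul ε).const_add 1
      · intro x
        by_cases hx : x ∈ A <;> simp [hx]
        linarith
      · intro x
        by_cases hx : x ∈ A <;> simp [hx]
        linarith
      · rw [← Finset.card_pos, hcard n hn1]
        omega
    have hlim := ge_of_tendsto (hα.add (ENNReal.tendsto_ofReal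
      (((hq.const_mul ε).const_add 1).const_mul _ |>.const_mul _))) hev
    have := hlim.trans (add_le_add hQ le_rfl)
    rw [← ENNReal.ofReal_mul hK.le, ← ENNReal.ofReal_add, ← mul_add,
      ENNReal.ofReal_le_ofReal_iff] at this
    · exact le_of_mul_le_mul_left this hK
    · have : 0 ≤ 1 - r / (r + 1) := by linarith
      positivity
    · have : 0 ≤ 1 - r / (r + 1) := by linarith
      positivity
    · positivity
  have hbound_top : ∀ δ > 0, 1 - 0 + γ * p - 4 * δ * m ≤
      (1 - r / (r + 1)) + r / (r + 1) * Real.exp (2 * l * δ) * (1 + ε * q) := by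
    intro δ hδ
    have hexp : Tendsto (fun M => Real.exp (-m * M)) atTop (𝓝 0) :=
      Real.tendsto_exp_atBot.comp (tendsto_id.const_mul_atTop_of_neg (by linarith))
    refine le_of_tendsto (((hexp.const_sub 1).add_const _).sub_const _) ?_
    filter_upwards [eventually_ge_atTop d] with M hM using hbound δ hδ M hM
  have hl1 : Tendsto (fun δ : ℝ => 1 - 0 + γ * p - 4 * δ * m) (𝓝[>] 0)
      (𝓝 (1 - 0 + γ * p - 4 * 0 * m)) :=
    Tendsto.mono_left (Continuous.tendsto (by fun_prop) 0) nhdsWithin_le_nhds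
  have hl2 : Tendsto (fun δ : ℝ => (1 - r / (r + 1)) +
      r / (r + 1) * Real.exp (2 * l * δ) * (1 + ε * q)) (𝓝[>] 0)
      (𝓝 ((1 - r / (r + 1)) + r / (r + 1) * Real.exp (2 * l * 0) * (1 + ε * q))) :=
    Tendsto.mono_left (Continuous.tendsto (by fun_prop) 0) nhdsWithin_le_nhds
  have := le_of_tendsto_of_tendsto hl1 hl2 (by
    filter_upwards [self_mem_nhdsWithin] with δ hδ using hbound_top δ hδ)
  simp only [mul_zero, zero_mul, Real.exp_zero] at this
  linarith

theorem eq_of_forall_rpow_sub_one_mul_le {ρ p q : ℝ} (hρ : ρ ≠ 0)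
    (h : ∀ ε : ℝ, |ε| < 1 → ((1 + ε) ^ ρ - 1) * p ≤ ρ * (ε * q)) : p = q := by
  have hmax : IsLocalMax (fun ε : ℝ => ((1 + ε) ^ ρ - 1) * p - ρ * (ε * q)) 0 := by
    filter_upwards [Metric.ball_mem_nhds (0 : ℝ) one_pos] with ε hε
    have := h ε (by simpa using hε)
    simp only [add_zero, Real.one_rpow, sub_self, zero_mul, mul_zero]
    linarith
  have hd : HasDerivAt (fun ε : ℝ => ((1 + ε) ^ ρ - 1) * p - ρ * (ε * q))
      ((1 * ρ * (1 + 0 : ℝ) ^ (ρ - 1)) * p - ρ * (1 * q)) 0 :=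
    (((((hasDerivAt_id (0 : ℝ)).const_add 1).rpow_const (by simp)).sub_const 1).mul_const p).sub
      (((hasDerivAt_id (0 : ℝ)).mul_const q).const_mul ρ)
  have h0 := hmax.hasDerivAt_eq_zero hd
  simp only [add_zero, Real.one_rpow, one_mul, mul_one] at h0
  exact mul_left_cancel₀ hρ (sub_eq_zero.1 h0)

/-- The empirical measure theorem for asymptotically `L^r`-optimal quantizers of an exponential
distribution. -/
theorem tendsto_ncard_inter_Icc_div {r l c d : ℝ} (hr : 0 < r) (hl : 0 < l) (hc : 0 ≤ c)
    (hcd : c ≤ d) {α : ℕ → Finset ℝ} (hcard : ∀ n, 1 ≤ n → (α n).card = n)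
    (hα : Tendsto (fun n : ℕ => (n : ℝ≥0∞) ^ r *
      qerr1 (volume.withDensity fun x => ENNReal.ofReal (expDensity l x)) r (α n)) atTop
        (𝓝 (Q1 (expDensity l) r))) :
    Tendsto (fun n : ℕ => (((α n : Set ℝ) ∩ Icc c d).ncard : ℝ) / n) atTop
      (𝓝 (Real.exp (-(l / (r + 1)) * c) - Real.exp (-(l / (r + 1)) * d))) := by
  rw [tendsto_iff_ultrafilter]
  intro U hU
  have hmem : ∀ᶠ n : ℕ in U, (((α n : Set ℝ) ∩ Icc c d).ncard : ℝ) / n ∈ Icc (0 : ℝ) 1 := by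
    filter_upwards [hU (eventually_ge_atTop 1)] with n hn
    refine ⟨by positivity, div_le_one_of_le₀ ?_ (by positivity)⟩
    have : ((α n : Set ℝ) ∩ Icc c d).ncard ≤ n := by
      refine (Set.ncard_le_ncard inter_subset_left (α n).finite_toSet).trans ?_
      rw [Set.ncard_coe_finset, hcard n hn]
    exact_mod_cast this
  obtain ⟨q, hqI, hq⟩ := isCompact_Icc.ultrafilter_le_nhds
    (U.map fun n : ℕ => (((α n : Set ℝ) ∩ Icc c d).ncard : ℝ) / n)
    (le_principal_iff.2 hmem)
  have : Real.exp (-(l / (r + 1)) * c) - Real.exp (-(l / (r + 1)) * d) = q := by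
    refine eq_of_forall_rpow_sub_one_mul_le (ρ := r / (r + 1)) (by positivity) fun ε hε => ?_
    exact empirical_inequality_of_tendsto hr (by positivity) (by field_simp) hc hcd hε hcard hU
      (hα.mono_left hU) hq hqI.1 hqI.2
  rw [this]
  exact hq

theorem ncard_scaleCB_inter_Icc {θ : ℝ} (hθ : 0 < θ) (α : Finset ℝ) (a b : ℝ) :
    ((scaleCB θ α : Set ℝ) ∩ Icc a b).ncard = ((α : Set ℝ) ∩ Icc (a / θ) (b / θ)).ncard := by
  have hinj : Function.Injective fun x : ℝ => θ * x := mul_right_injective₀ hθ.ne'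
  rw [← Set.ncard_image_of_injective ((α : Set ℝ) ∩ Icc (a / θ) (b / θ)) hinj]
  congr 1
  ext x
  simp only [scaleCB, Finset.coe_image, mem_inter_iff, mem_image, mem_Icc]
  constructor
  · rintro ⟨⟨y, hy, rfl⟩, h1, h2⟩
    exact ⟨y, ⟨hy, (div_le_iff₀' hθ).2 h1, (le_div_iff₀' hθ).2 h2⟩, rfl⟩
  · rintro ⟨y, ⟨hy, h1, h2⟩, rfl⟩
    exact ⟨⟨y, hy, rfl⟩, (div_le_iff₀' hθ).1 h1, (le_div_iff₀' hθ).1 h2⟩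

/-- **Proposition 5.5, empirical measure theorem, exponential.**
Let `r, s > 0`, `X ~ E(λ)`, `(α_n)` asymptotically `L^r(P)`-optimal with
`card α_n = n`, and `θ* = (s+1)/(r+1)`.  Then
`C_{f,s} = ∫_0^∞ f^{1/(1+s)} = λ^{-s/(1+s)}(1+s)` and for all `0 ≤ a ≤ b`,
`(1/n) card(θ*·α_n ∩ [a,b]) → (1/C_{f,s}) ∫_a^b f(x)^{1/(1+s)} dx`. -/
theorem stmt_17 (r s : ℝ) (hr : 0 < r) (hs : 0 < s) (l : ℝ) (hl : 0 < l)
    (P : Measure ℝ)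
    (hP : P = volume.withDensity fun x => ENNReal.ofReal (expDensity l x))
    (α : ℕ → Finset ℝ) (hcard : ∀ n, 1 ≤ n → (α n).card = n)
    (hα : AsympOptimalSeq1 P (expDensity l) r α)
    (a b : ℝ) (ha : 0 ≤ a) (hab : a ≤ b) :
    (∫ x in Ioi (0 : ℝ), expDensity l x ^ (1 / (1 + s))) =
      l ^ (-(s / (1 + s))) * (1 + s) ∧
    Tendsto (fun n : ℕ =>
        ((((scaleCB ((s + 1) / (r + 1)) (α n) : Finset ℝ) : Set ℝ) ∩
          Icc a b).ncard : ℝ) / n)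
      atTop
      (𝓝 ((1 / ∫ x in Ioi (0 : ℝ), expDensity l x ^ (1 / (1 + s))) *
        ∫ x in Icc a b, expDensity l x ^ (1 / (1 + s)))) := by
  subst hP
  have hθ : 0 < (s + 1) / (r + 1) := by positivity
  have hC := integral_expDensity_rpow hl hs
  constructor
  · rw [hC, one_div_div, show -(s / (1 + s)) = 1 / (1 + s) - 1 by field_simp; ring,
      Real.rpow_sub_one hl.ne']
    ring
  · have h := tendsto_ncard_inter_Icc_div hr hl (div_nonneg ha hθ.le)
      (div_le_div_of_nonneg_right hab hθ.le) hcard hα.2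
    simp only [ncard_scaleCB_inter_Icc hθ]
    convert h using 2
    rw [hC, setIntegral_Icc_expDensity_rpow hl hs ha hab]
    have hC0 : l ^ (1 / (1 + s)) * (1 / (l / (1 + s))) ≠ 0 := by positivity
    have hx : ∀ x, -(l / (r + 1)) * (x / ((s + 1) / (r + 1))) = -(l / (1 + s)) * x := by
      intro x
      rw [add_comm 1 s]
      field_simp
    rw [hx, hx, ← mul_assoc, one_div_mul_cancel hC0, one_mul]
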